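/- Let m ≥ 1 and n ≥ 4 be integers. Define integer sequences (a_l) and (b_l) by a_1 = 1, a_2 = m+2, a_l = (m+2)a_{l−1} − a_{l−2} for l ≥ 3, and b_1 = 0, b_2 = n−2, b_l = (m+2)b_{l−1} − b_{l−2} + (n−l+1) for l ≥ 3. Then the n×n integer matrix (m+n)·I_n − L(P_n^c) is unimodularly equivalent over ℤ to the block diagonal matrix I_{n−2} ⊕ [[m+n, b_n],[0, a_n]]. -/

import Mathlib

open Matrix SimpleGraph

instance pathGraph.adjDecidable (n : ℕ) : DecidableRel (pathGraph n).Adj := fun _ _ =>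
  decidable_of_iff _ pathGraph_adj.symm

/-- Unimodular equivalence over ℤ of integer matrices (up to a bijection identifying the
index types): `B = P * A * Q` for integer matrices `P`, `Q` of determinant `±1`. -/
def MatrixUnimodEquiv {ι₁ ι₂ κ₁ κ₂ : Type*}
    [Fintype ι₁] [Fintype ι₂] [Fintype κ₁] [Fintype κ₂]
    [DecidableEq ι₁] [DecidableEq ι₂] [DecidableEq κ₁] [DecidableEq κ₂]
    (A : Matrix ι₁ ι₂ ℤ) (B : Matrix κ₁ κ₂ ℤ) : Prop :=
  ∃ (e₁ : ι₁ ≃ κ₁) (e₂ : ι₂ ≃ κ₂) (P : Matrix κ₁ κ₁ ℤ) (Q : Matrix κ₂ κ₂ ℤ),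
    (P.det = 1 ∨ P.det = -1) ∧ (Q.det = 1 ∨ Q.det = -1) ∧
    P * (Matrix.reindex e₁ e₂ A) * Q = B

/-- Summing a function supported at one value. -/
theorem aux_sum_single (n c : ℕ) (f : ℕ → ℤ) :
    ∑ j : Fin n, (if (j : ℕ) = c then f j else 0) = if c < n then f c else 0 := by
  rw [Fin.sum_univ_eq_sum_range (fun j => if j = c then f j else 0) n]
  simp

theorem aux_sum_single_succ (n c : ℕ) (f : ℕ → ℤ) (hc : c < n) :
    ∑ j : Fin n, (if (j : ℕ) + 1 = c then f j else 0) = if 0 < c then f (c - 1) else 0 := by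
  rcases Nat.eq_zero_or_pos c with h | h
  · subst h; simp
  · rw [if_pos h]
    have := aux_sum_single n (c - 1) f
    rw [if_pos (by omega)] at this
    rw [← this]
    refine Finset.sum_congr rfl fun j _ => ?_
    have : ((j : ℕ) + 1 = c) ↔ ((j : ℕ) = c - 1) := by omega
    simp only [this]

/-- The matrix `mI + J + L(P_n)`. -/
def auxM (m k : ℕ) : Matrix (Fin (k + 2)) (Fin (k + 2)) ℤ := fun i j =>
  if (i : ℕ) = j then (m : ℤ) + 1 + (if (i : ℕ) < k + 1 then 1 else 0) + (if 0 < (i : ℕ) then 1 else 0)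
  else if (i : ℕ) + 1 = j ∨ (j : ℕ) + 1 = i then 0 else 1

/-- The difference matrix. -/
def auxP (k : ℕ) : Matrix (Fin (k + 2)) (Fin (k + 2)) ℤ := fun i j =>
  (if (j : ℕ) = i then 1 else 0) - (if (j : ℕ) = i + 1 then 1 else 0)

def auxN (m k : ℕ) : Matrix (Fin (k + 2)) (Fin (k + 2)) ℤ := fun i j =>
  if (i : ℕ) = k + 1 then
    (if (j : ℕ) = k + 1 then (m : ℤ) + k + 2 else if (j : ℕ) = k then k else (j : ℤ) + 1)
  else if (j : ℕ) = k + 1 then 0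
  else (if (j : ℕ) = i then (m : ℤ) + 2 else 0) - (if (j : ℕ) = i + 1 then 1 else 0)
    - (if (j : ℕ) + 1 = i then 1 else 0)

def auxv (k : ℕ) (a : ℕ → ℤ) (i : ℕ) : ℤ := if i = k + 1 then 0 else a (i + 1)

def auxV (k : ℕ) (a : ℕ → ℤ) : Matrix (Fin (k + 2)) (Fin (k + 2)) ℤ := fun i j =>
  if (j : ℕ) = 0 then auxv k a i else if i = j then 1 else 0

theorem auxM_eq (m k : ℕ) :
    (((m : ℤ) + (k + 2 : ℕ)) • (1 : Matrix (Fin (k + 2)) (Fin (k + 2)) ℤ)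
      - (pathGraph (k + 2))ᶜ.lapMatrix ℤ) = auxM m k := by
  have hdeg : ∀ i : Fin (k + 2), (((pathGraph (k + 2))ᶜ.degree i : ℕ) : ℤ) =
      (k + 2 : ℤ) - 1 - (if (i : ℕ) < k + 1 then 1 else 0) - (if 0 < (i : ℕ) then 1 else 0) := by
    intro i
    have h1 : (((pathGraph (k + 2))ᶜ.degree i : ℕ) : ℤ) =
        ∑ j : Fin (k + 2), (1 - (if (j : ℕ) = i then 1 else 0)
          - (if (j : ℕ) = i + 1 then 1 else 0) - (if (j : ℕ) + 1 = i then (1 : ℤ) else 0)) := by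
      rw [← SimpleGraph.card_neighborFinset_eq_degree, Finset.card_eq_sum_ones,
        SimpleGraph.neighborFinset_eq_filter, Finset.sum_filter]
      push_cast
      refine Finset.sum_congr rfl fun j _ => ?_
      simp only [SimpleGraph.compl_adj, pathGraph_adj, ne_eq, Fin.ext_iff]
      split_ifs <;> first | omega | rfl
    rw [h1]
    simp only [Finset.sum_sub_distrib]
    rw [aux_sum_single (k + 2) i (fun _ => 1), aux_sum_single (k + 2) (i + 1) (fun _ => 1),
      aux_sum_single_succ (k + 2) i (fun _ => 1) i.2]
    have := i.2
    simp only [Finset.sum_const, Finset.card_univ, Fintype.card_fin]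
    split_ifs <;> first | omega | (push_cast; ring)
  ext i j
  simp only [SimpleGraph.lapMatrix, SimpleGraph.degMatrix, Matrix.sub_apply, Matrix.smul_apply,
    Matrix.one_apply, Matrix.diagonal_apply, SimpleGraph.adjMatrix_apply, hdeg, auxM,
    SimpleGraph.compl_adj, pathGraph_adj, ne_eq, Fin.ext_iff, smul_eq_mul]
  split_ifs <;> first | omega | (push_cast; ring)

set_option maxHeartbeats 2000000 in
theorem auxPM (m k : ℕ) : auxP k * auxM m k = auxN m k * auxP k := by
  ext i j
  have hi := i.2
  have hj := j.2
  rw [Matrix.mul_apply, Matrix.mul_apply]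
  have hL : ∑ x, auxP k i x * auxM m k x j =
      auxM m k i j - (if h : (i : ℕ) + 1 < k + 2 then auxM m k ⟨i + 1, h⟩ j else 0) := by
    simp only [auxP, sub_mul, ite_mul, one_mul, zero_mul, Finset.sum_sub_distrib]
    congr 1
    · simp [← Fin.ext_iff]
    · split_ifs with h
      · rw [Finset.sum_eq_single ⟨i + 1, h⟩] <;> simp +contextual [Fin.ext_iff]
      · refine Finset.sum_eq_zero fun x _ => ?_
        rw [if_neg]; omega
  have hR : ∑ x, auxN m k i x * auxP k x j =
      auxN m k i j - (if h : 0 < (j : ℕ) then auxN m k i ⟨j - 1, by omega⟩ else 0) := by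
    simp only [auxP, mul_sub, mul_ite, mul_one, mul_zero, Finset.sum_sub_distrib]
    congr 1
    · simp [← Fin.ext_iff]
    · split_ifs with h
      · rw [Finset.sum_eq_single ⟨j - 1, by omega⟩]
        · rw [if_pos]; simp; omega
        · intro b _ hb
          rw [if_neg]
          intro hx; apply hb; ext; simp; omega
        · simp
      · refine Finset.sum_eq_zero fun x _ => ?_
        rw [if_neg]; omega
  rw [hL, hR]
  simp only [auxM, auxN]
  have hcase : (j : ℕ) + 1 < i ∨ (j : ℕ) + 1 = i ∨ (j : ℕ) = i ∨ (j : ℕ) = i + 1 ∨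
    (j : ℕ) = i + 2 ∨ (i : ℕ) + 2 < j := by omega
  have hicase : (i : ℕ) = k + 1 ∨ (i : ℕ) = k ∨ (i : ℕ) < k := by omega
  have hjcase : (j : ℕ) = k + 1 ∨ (j : ℕ) = k ∨ (j : ℕ) < k := by omega
  have hi0 : (i : ℕ) = 0 ∨ 0 < (i : ℕ) := by omega
  have hj0 : (j : ℕ) = 0 ∨ 0 < (j : ℕ) := by omega
  clear hL hR
  rcases hicase with h1 | h1 | h1 <;> rcases hcase with h | h | h | h | h | h <;>
  rcases hjcase with h2 | h2 | h2 <;> rcases hi0 with h3 | h3 <;> rcases hj0 with h4 | h4 <;>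
  first
  | (exfalso; omega)
  | (simp (disch := omega) only [if_pos, if_neg, dif_pos, dif_neg]; omega)
  | (simp (disch := omega) only [if_pos, if_neg, dif_pos, dif_neg]; split_ifs <;> omega)

theorem auxP_det (k : ℕ) : (auxP k).det = 1 := by
  rw [Matrix.det_of_isUpperTriangular]
  · simp [auxP]
  · intro i j hij
    have : (j : ℕ) < i := hij
    simp only [auxP]
    rw [if_neg (by omega), if_neg (by omega)]; rfl

theorem auxV_det (k : ℕ) (a : ℕ → ℤ) (ha1 : a 1 = 1) : (auxV k a).det = 1 := by
  rw [Matrix.det_of_isLowerTriangular]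
  · apply Finset.prod_eq_one
    intro i _
    simp only [auxV, auxv]
    split_ifs with h1 h2
    · omega
    · simp [h1, ha1]
    · rfl
  · intro i j hij
    have : (i : ℕ) < j := hij
    simp only [auxV, Fin.ext_iff]
    rw [if_neg (by omega), if_neg (by omega)]

theorem aux_b (m k : ℕ) (hk : 2 ≤ k) (a b : ℕ → ℤ)
    (ha1 : a 1 = 1) (ha2 : a 2 = (m : ℤ) + 2)
    (ha : ∀ l, 3 ≤ l → a l = ((m : ℤ) + 2) * a (l - 1) - a (l - 2))
    (hb : ∀ l, 3 ≤ l → b l = ((m : ℤ) + 2) * b (l - 1) - b (l - 2) + (((k + 2 : ℕ) : ℤ) - l + 1))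
    (t : ℕ) (ht : t + 1 ≤ k) :
    b (k + 2) = a (t + 2) * b (k + 1 - t) - a (t + 1) * b (k - t)
      + ∑ i ∈ Finset.range (t + 1), ((i : ℤ) + 1) * a (i + 1) := by
  induction t with
  | zero =>
    have := hb (k + 2) (by omega)
    simp only [Nat.add_sub_cancel, show k + 2 - 1 = k + 1 by omega] at this
    simp [ha1, ha2, this]
  | succ t ih =>
    rw [ih (by omega), Finset.sum_range_succ _ (t + 1)]
    have h1 := hb (k + 1 - t) (by omega)
    have h2 := ha (t + 3) (by omega)
    rw [show k + 1 - t - 1 = k - t by omega, show k + 1 - t - 2 = k - (t + 1) by omega,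
      Nat.cast_sub (by omega)] at h1
    rw [show t + 3 - 1 = t + 2 by omega, show t + 3 - 2 = t + 1 by omega] at h2
    rw [show k + 1 - (t + 1) = k - t by omega, show t + 1 + 2 = t + 3 by omega,
      show t + 1 + 1 = t + 2 by omega, h1, h2]
    push_cast
    ring

theorem aux_Nv (m k : ℕ) (hk : 2 ≤ k) (a b : ℕ → ℤ)
    (ha1 : a 1 = 1) (ha2 : a 2 = (m : ℤ) + 2)
    (ha : ∀ l, 3 ≤ l → a l = ((m : ℤ) + 2) * a (l - 1) - a (l - 2))
    (hb1 : b 1 = 0) (hb2 : b 2 = ((k + 2 : ℕ) : ℤ) - 2)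
    (hb : ∀ l, 3 ≤ l → b l = ((m : ℤ) + 2) * b (l - 1) - b (l - 2) + (((k + 2 : ℕ) : ℤ) - l + 1))
    (i : Fin (k + 2)) :
    ∑ x : Fin (k + 2), auxN m k i x * auxv k a x =
      if (i : ℕ) = k + 1 then b (k + 2) else if (i : ℕ) = k then a (k + 2) else 0 := by
  have hi := i.2
  rw [Fin.sum_univ_castSucc]
  have hlast : auxv k a ((Fin.last (k + 1) : Fin (k + 2)) : ℕ) = 0 := by simp [auxv]
  rw [hlast, mul_zero, add_zero]
  split_ifs with h1 h2
  · rw [Fin.sum_univ_castSucc]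
    have := aux_b m k hk a b ha1 ha2 ha hb (k - 1) (by omega)
    rw [show k - 1 + 2 = k + 1 by omega, show k + 1 - (k - 1) = 2 by omega,
      show k - 1 + 1 = k by omega, show k - (k - 1) = 1 by omega, hb1, hb2,
      ← Fin.sum_univ_eq_sum_range (fun i => ((i : ℤ) + 1) * a (i + 1))] at this
    rw [this]
    have e : ∀ x : Fin k, auxN m k i x.castSucc.castSucc * auxv k a (x.castSucc.castSucc : Fin (k+2))
        = ((x : ℕ) + 1 : ℤ) * a (x + 1) := by
      intro x
      have := x.2
      simp only [auxN, auxv, Fin.val_castSucc]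
      rw [if_pos h1, if_neg (by omega), if_neg (by omega), if_neg (by omega)]
    rw [Finset.sum_congr rfl fun x _ => e x]
    simp [auxN, auxv, h1]
    ring
  all_goals
    have e : ∀ x : Fin (k + 1), auxN m k i x.castSucc * auxv k a (x.castSucc : Fin (k+2))
        = (if (x : ℕ) = i then ((m : ℤ) + 2) * a (x + 1) else 0)
          - (if (x : ℕ) = i + 1 then a (x + 1) else 0)
          - (if (x : ℕ) + 1 = i then a (x + 1) else 0) := by
      intro x
      have := x.2
      simp only [auxN, auxv, Fin.val_castSucc]
      have h3 : (x : ℕ) ≠ k + 1 := by omega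
      rw [if_neg h1, if_neg h3, if_neg h3]
      split_ifs <;> ring
    rw [Finset.sum_congr rfl fun x _ => e x]
    simp only [Finset.sum_sub_distrib]
    rw [aux_sum_single (k + 1) i (fun x => ((m : ℤ) + 2) * a (x + 1)),
      aux_sum_single (k + 1) (i + 1) (fun x => a (x + 1)),
      aux_sum_single_succ (k + 1) i (fun x => a (x + 1)) (by omega)]
  · have := ha (k + 2) (by omega)
    rw [show k + 2 - 1 = k + 1 by omega, show k + 2 - 2 = k by omega] at this
    rw [if_pos (by omega), if_neg (by omega), if_pos (by omega), h2, this,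
      show k - 1 + 1 = k by omega]
    ring
  · rw [if_pos (by omega), if_pos (by omega)]
    rcases Nat.eq_zero_or_pos (i : ℕ) with h | h
    · simp [h, ha1, ha2]
    · have := ha (i + 2) (by omega)
      rw [show (i : ℕ) + 2 - 1 = i + 1 by omega, show (i : ℕ) + 2 - 2 = i by omega] at this
      rw [if_pos h, show (i : ℕ) - 1 + 1 = i by omega, show (i : ℕ) + 1 + 1 = i + 2 by omega, this]
      ring

theorem aux_NV (m k : ℕ) (a : ℕ → ℤ) (i j : Fin (k + 2)) :
    (auxN m k * auxV k a) i j =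
      if (j : ℕ) = 0 then ∑ x : Fin (k + 2), auxN m k i x * auxv k a x else auxN m k i j := by
  rw [Matrix.mul_apply]
  split_ifs with h
  · simp [auxV, h]
  · simp [auxV, h]

def auxf (k : ℕ) : Fin k ⊕ Fin 2 → Fin (k + 2) :=
  Sum.elim (fun i => ⟨i, by omega⟩) ![⟨k + 1, by omega⟩, ⟨k, by omega⟩]

def auxg (k : ℕ) : Fin k ⊕ Fin 2 → Fin (k + 2) :=
  Sum.elim (fun i => ⟨i + 1, by omega⟩) ![⟨k + 1, by omega⟩, ⟨0, by omega⟩]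

theorem auxf_bij (k : ℕ) : Function.Bijective (auxf k) := by
  rw [Fintype.bijective_iff_injective_and_card]
  refine ⟨?_, by simp⟩
  rintro (x | x) (y | y) h
  · simp [auxf, Fin.ext_iff] at h; simp [Fin.ext_iff, h]
  · have := x.2
    fin_cases y <;> simp [auxf, Fin.ext_iff] at h <;> omega
  · have := y.2
    fin_cases x <;> simp [auxf, Fin.ext_iff] at h <;> omega
  · fin_cases x <;> fin_cases y <;> simp [auxf] at h ⊢

theorem auxg_bij (k : ℕ) : Function.Bijective (auxg k) := by
  rw [Fintype.bijective_iff_injective_and_card]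
  refine ⟨?_, by simp⟩
  rintro (x | x) (y | y) h
  · simp [auxg, Fin.ext_iff] at h; simp [Fin.ext_iff, h]
  · have := x.2
    fin_cases y <;> simp [auxg, Fin.ext_iff] at h <;> omega
  · have := y.2
    fin_cases x <;> simp [auxg, Fin.ext_iff] at h <;> omega
  · fin_cases x <;> fin_cases y <;> simp [auxg] at h ⊢

/-- The triangular block. -/
def auxE (m k : ℕ) : Matrix (Fin k) (Fin k) ℤ := fun i j =>
  auxN m k (auxf k (Sum.inl i)) (auxg k (Sum.inl j))

def auxF (m k : ℕ) : Matrix (Fin 2) (Fin k) ℤ := fun i j =>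
  auxN m k (auxf k (Sum.inr i)) (auxg k (Sum.inl j))

theorem auxE_det (m k : ℕ) : (auxE m k).det = (-1) ^ k := by
  rw [Matrix.det_of_isLowerTriangular]
  · rw [Finset.prod_eq_pow_card (b := (-1 : ℤ))]
    · simp
    · intro i _
      have := i.2
      simp only [auxE, auxN, auxf, auxg, Sum.elim_inl]
      split_ifs <;> omega
  · intro i j hij
    have : (i : ℕ) < j := hij
    simp only [auxE, auxN, auxf, auxg, Sum.elim_inl]
    split_ifs <;> omega

/-- Lemma 2.2: `(m+n)Iₙ − L(Pₙᶜ) ∼ I_{n−2} ⊕ [[m+n, bₙ],[0, aₙ]]`. -/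
theorem lem_2_2 (m n : ℕ) (hm : 1 ≤ m) (hn : 4 ≤ n)
    (a b : ℕ → ℤ)
    (ha1 : a 1 = 1) (ha2 : a 2 = (m : ℤ) + 2)
    (ha : ∀ l, 3 ≤ l → a l = ((m : ℤ) + 2) * a (l - 1) - a (l - 2))
    (hb1 : b 1 = 0) (hb2 : b 2 = (n : ℤ) - 2)
    (hb : ∀ l, 3 ≤ l → b l = ((m : ℤ) + 2) * b (l - 1) - b (l - 2) + ((n : ℤ) - l + 1)) :
    MatrixUnimodEquiv
      (((m : ℤ) + n) • (1 : Matrix (Fin n) (Fin n) ℤ) - (pathGraph n)ᶜ.lapMatrix ℤ)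
      (Matrix.fromBlocks
        (1 : Matrix (Fin (n - 2)) (Fin (n - 2)) ℤ) 0 0
        !![(m : ℤ) + n, b n; 0, a n]) := by
  obtain ⟨k, rfl⟩ : ∃ k, n = k + 2 := ⟨n - 2, by omega⟩
  have hk : 2 ≤ k := by omega
  rw [auxM_eq]
  change MatrixUnimodEquiv (auxM m k) (Matrix.fromBlocks (1 : Matrix (Fin k) (Fin k) ℤ) 0 0
        !![(m : ℤ) + (k + 2 : ℕ), b (k + 2); 0, a (k + 2)])
  set X : Matrix (Fin k ⊕ Fin 2) (Fin k ⊕ Fin 2) ℤ :=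
    Matrix.fromBlocks (auxE m k) 0 (auxF m k) 1 with hX
  have hXdet : X.det = (-1) ^ k := by
    rw [hX, Matrix.det_fromBlocks_zero₁₂, auxE_det, Matrix.det_one, mul_one]
  have hXu : IsUnit X.det := by
    rw [hXdet]; exact (isUnit_one.neg).pow k
  have hPu : IsUnit (auxP k).det := by rw [auxP_det]; exact isUnit_one
  set e₁ := (Equiv.ofBijective _ (auxf_bij k)).symm with he₁
  set e₂ := (Equiv.ofBijective _ (auxg_bij k)).symm with he₂
  have key : Matrix.reindex e₁ e₂ (auxN m k * auxV k a) =
      X * (Matrix.fromBlocks (1 : Matrix (Fin k) (Fin k) ℤ) 0 0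
        !![(m : ℤ) + (k + 2 : ℕ), b (k + 2); 0, a (k + 2)]) := by
    rw [hX, Matrix.fromBlocks_multiply]
    ext i j
    have h0 : Matrix.reindex e₁ e₂ (auxN m k * auxV k a) i j =
        (auxN m k * auxV k a) (auxf k i) (auxg k j) := rfl
    rw [h0, aux_NV, aux_Nv m k hk a b ha1 ha2 ha hb1 hb2 hb]
    rcases i with i | i <;> rcases j with j | j
    · simp [auxE, auxg]
    · have := i.2
      fin_cases j <;> simp [auxg, auxf, auxN] <;> omega
    · simp [auxF, auxg]
    · fin_cases i <;> fin_cases j <;> simp [auxg, auxf, auxN] <;> ring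
  have hint : ∀ z : ℤ, IsUnit z → z = 1 ∨ z = -1 := fun z hz => Int.isUnit_iff.mp hz
  refine ⟨e₁, e₂, X⁻¹ * Matrix.reindex e₁ e₁ (auxP k),
    Matrix.reindex e₂ e₂ ((auxP k)⁻¹ * auxV k a), ?_, ?_, ?_⟩
  · apply hint
    rw [Matrix.det_mul, Matrix.det_reindex_self]
    exact (Matrix.isUnit_nonsing_inv_det X hXu).mul hPu
  · apply hint
    rw [Matrix.det_reindex_self, Matrix.det_mul, auxV_det k a ha1, mul_one]
    exact Matrix.isUnit_nonsing_inv_det _ hPu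
  · have h2 : Matrix.reindex e₁ e₁ (auxP k) * Matrix.reindex e₁ e₂ (auxM m k) *
        Matrix.reindex e₂ e₂ ((auxP k)⁻¹ * auxV k a) =
        Matrix.reindex e₁ e₂ (auxN m k * auxV k a) := by
      simp only [Matrix.reindex_apply, Matrix.submatrix_mul_equiv]
      rw [auxPM, Matrix.mul_assoc, ← Matrix.mul_assoc (auxP k), Matrix.mul_nonsing_inv _ hPu,
        Matrix.one_mul]
    rw [Matrix.mul_assoc X⁻¹, Matrix.mul_assoc X⁻¹, h2, key, ← Matrix.mul_assoc,
      Matrix.nonsing_inv_mul _ hXu, Matrix.one_mul]
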